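/- arXiv:math/0401197 — 2 statements merged into one kernel-verified Lean document; each statement's English description precedes it below -/
import Mathlib

section
/- Let Λ ⊆ Γ_p be a congruence subgroup and for ε > 0 let V_ε(H⁺(ℝⁿ)) = {x ∈ H⁺(ℝⁿ) : ‖x_1 e_1 + … + x_{n−1} e_{n−1}‖ ≤ 1/ε and x_n > ε} be the vertical strip. Then for every ε > 0 there exists a real ρ > 0 such that for every matrix (a,b;c,d) ∈ Λ and every τ ∈ V_ε(H⁺(ℝⁿ)) one has ‖cτ + d‖ ≥ ρ · ‖c e_n + d‖. -/
noncomputable section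

open CliffordAlgebra Filter

attribute [local instance] Classical.propDecidable

/-- The quadratic form `-(x₁² + ⋯ + xₙ²)` on `ℝⁿ`, so that in the associated Clifford
algebra one has `x * x = -‖x‖²`, i.e. `eᵢeⱼ + eⱼeᵢ = -2δᵢⱼ`. -/
def Qf (n : ℕ) : QuadraticForm ℝ (Fin n → ℝ) :=
  QuadraticMap.weightedSumSquares ℝ (fun _ : Fin n => (-1 : ℝ))

/-- The real Clifford algebra `Cl_n`. -/
abbrev Cl (n : ℕ) := CliffordAlgebra (Qf n)

/-- The embedding of a vector of `ℝⁿ` into `Cl_n`. -/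
def clVec {n : ℕ} (x : Fin n → ℝ) : Cl n := CliffordAlgebra.ι (Qf n) x

/-- The canonical basis vectors `e_i` inside `Cl_n` (0-indexed: `eCl i` is `e_{i+1}`). -/
def eCl {n : ℕ} (i : Fin n) : Cl n := clVec (Pi.single i 1)

/-- The reversion anti-automorphism `a ↦ a*`. -/
def clRev {n : ℕ} (a : Cl n) : Cl n := CliffordAlgebra.reverse a

/-- The conjugation anti-automorphism `a ↦ ā` (reversion composed with grade involution). -/
def clConj {n : ℕ} (a : Cl n) : Cl n := CliffordAlgebra.reverse (CliffordAlgebra.involute a)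

/-- `(a*)‾`, the conjugate of the reversion of `a`. -/
def crev {n : ℕ} (a : Cl n) : Cl n := clConj (clRev a)

/-- The scalar part `Sc a` of a Clifford number (the coefficient of `e_∅ = 1`). -/
def Sc {n : ℕ} (a : Cl n) : ℝ :=
  ExteriorAlgebra.algebraMapInv ((CliffordAlgebra.equivExterior (Qf n)) a)

/-- The vector (grade-one) part of a Clifford number, as an element of `ℝⁿ`. -/
def vecPart {n : ℕ} (a : Cl n) : Fin n → ℝ :=
  ExteriorAlgebra.ιInv ((CliffordAlgebra.equivExterior (Qf n)) a)

/-- The Clifford norm `‖a‖ = (Σ_A a_A²)^{1/2} = (Sc (a ā))^{1/2}`. -/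
def clNorm {n : ℕ} (a : Cl n) : ℝ := Real.sqrt (Sc (a * clConj a))

/-- The last ("vertical") coordinate `x_n` of a vector `x ∈ ℝⁿ`. -/
def lastc (n : ℕ) (x : Fin n → ℝ) : ℝ :=
  if h : 0 < n then x ⟨n - 1, by omega⟩ else 0

/-- The upper half-space `H⁺(ℝⁿ) = {x ∈ ℝⁿ : x_n > 0}`. -/
def upH (n : ℕ) : Set (Fin n → ℝ) := {x | 0 < lastc n x}

/-- Replace the last coordinate of `x` by `t`. -/
def setLast {n : ℕ} (x : Fin n → ℝ) (t : ℝ) : Fin n → ℝ :=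
  fun j => if (j : ℕ) = n - 1 then t else x j

/-- The last basis vector `e_n` of `ℝⁿ`. -/
def enVec (n : ℕ) : Fin n → ℝ := fun j => if (j : ℕ) = n - 1 then 1 else 0

/-- `ω ∈ ℤ^{n-1} = ℤe₁ + ⋯ + ℤe_{n-1}`: an integer vector with vanishing last coordinate. -/
def horPart (n : ℕ) (ω : Fin n → ℤ) : Prop := ∀ j : Fin n, (j : ℕ) = n - 1 → ω j = 0

/-- The real vector associated to an integer lattice point. -/
def latVec {n : ℕ} (ω : Fin n → ℤ) : Fin n → ℝ := fun j => (ω j : ℝ)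

/-- The vertical strip `V_ε(H⁺(ℝⁿ))`. -/
def Vstrip (n : ℕ) (ε : ℝ) : Set (Fin n → ℝ) :=
  {x | clNorm (clVec (setLast x 0)) ≤ 1 / ε ∧ ε < lastc n x}

/-- The kernel `q^{(s)}_0`, evaluated on a Clifford number:
`q^{(s)}_0(a) = a/‖a‖^{n+1-s}` for odd `s`, `q^{(s)}_0(a) = 1/‖a‖^{n-s}` for even `s`. -/
def qker {n : ℕ} (s : ℕ) (a : Cl n) : Cl n :=
  if Odd s then ((clNorm a) ^ (n + 1 - s))⁻¹ • a
  else algebraMap ℝ (Cl n) ((clNorm a ^ (n - s))⁻¹)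

/-- `q^{(s)}_0` as a function on `ℝⁿ`. -/
def qfun {n : ℕ} (s : ℕ) (x : Fin n → ℝ) : Cl n := qker s (clVec x)

/-- The `i`-th partial derivative of a `Cl_n`-valued function, detected componentwise
through all real-linear functionals. -/
def clPDeriv {n : ℕ} (i : Fin n) (f : (Fin n → ℝ) → Cl n) (x : Fin n → ℝ) : Cl n :=
  if h : ∃ v : Cl n, ∀ φ : Cl n →ₗ[ℝ] ℝ,
      HasDerivAt (fun t : ℝ => φ (f (Function.update x i (x i + t)))) (φ v) 0
  then h.choose else 0

/-- The (left) Euclidean Dirac operator `D f = Σ eᵢ ∂f/∂xᵢ`. -/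
def Dirac {n : ℕ} (f : (Fin n → ℝ) → Cl n) (x : Fin n → ℝ) : Cl n :=
  ∑ i : Fin n, eCl i * clPDeriv i f x

/-- The right Euclidean Dirac operator `f D = Σ (∂f/∂xᵢ) eᵢ`. -/
def DiracR {n : ℕ} (f : (Fin n → ℝ) → Cl n) (x : Fin n → ℝ) : Cl n :=
  ∑ i : Fin n, clPDeriv i f x * eCl i

/-- The iterated Dirac operator `D^s`. -/
def DiracIter {n : ℕ} : ℕ → ((Fin n → ℝ) → Cl n) → ((Fin n → ℝ) → Cl n)
  | 0, f => f
  | (s + 1), f => Dirac (DiracIter s f)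

/-- The iterated right Dirac operator. -/
def DiracRIter {n : ℕ} : ℕ → ((Fin n → ℝ) → Cl n) → ((Fin n → ℝ) → Cl n)
  | 0, f => f
  | (s + 1), f => DiracR (DiracRIter s f)

/-- The `i`-th partial derivative of a real-valued function. -/
def pdR {n : ℕ} (i : Fin n) (g : (Fin n → ℝ) → ℝ) (x : Fin n → ℝ) : ℝ :=
  deriv (fun t : ℝ => g (Function.update x i (x i + t))) 0

/-- Iterated partial derivative in one fixed direction. -/
def clPDerivIter {n : ℕ} (i : Fin n) : ℕ → ((Fin n → ℝ) → Cl n) → ((Fin n → ℝ) → Cl n)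
  | 0, f => f
  | (k + 1), f => clPDeriv i (clPDerivIter i k f)

/-- The mixed partial derivative `∂^{|m|}/∂x^m` for a multi-index `m ∈ ℕ₀ⁿ`. -/
def multiPDeriv {n : ℕ} (m : Fin n → ℕ) (f : (Fin n → ℝ) → Cl n) : (Fin n → ℝ) → Cl n :=
  (List.finRange n).foldr (fun i g => clPDerivIter i (m i) g) f

/-- Convergence of a series of Clifford numbers to `a`, detected componentwise through
all real-linear functionals. -/
def HasClSum {n : ℕ} {ι : Type*} (g : ι → Cl n) (a : Cl n) : Prop :=
  ∀ φ : Cl n →ₗ[ℝ] ℝ, HasSum (fun i => φ (g i)) (φ a)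

/-- Index set for the Eisenstein series `G_m`: `(α,ω) ∈ ℤ × ℤ^{n-1}`, `(α,ω) ≠ (0,0)`. -/
def GmIdx (n : ℕ) : Type := {v : ℤ × (Fin n → ℤ) // horPart n v.2 ∧ v ≠ 0}

/-- The summand `q^{(1)}_m(αx + ω)` of the monogenic Eisenstein series `G_m`. -/
def Gterm {n : ℕ} (m : Fin n → ℕ) (x : Fin n → ℝ) (v : GmIdx n) : Cl n :=
  multiPDeriv m (qfun 1) ((v.1.1 : ℝ) • x + latVec v.1.2)

/-- The monogenic Eisenstein series `G_m(x) = Σ_{(α,ω) ≠ 0} q^{(1)}_m(αx + ω)`. -/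
def Gm {n : ℕ} (m : Fin n → ℕ) (x : Fin n → ℝ) : Cl n :=
  if h : ∃ a : Cl n, HasClSum (Gterm m x) a then h.choose else 0
/-- The group of invertible `2 × 2` matrices with entries in `Cl_n`. -/
abbrev GL2 (n : ℕ) := (Matrix (Fin 2) (Fin 2) (Cl n))ˣ

/-- The `(i,j)` entry of an invertible Clifford matrix. -/
def ent {n : ℕ} (M : GL2 n) (i j : Fin 2) : Cl n :=
  M.val i j

/-- The translation matrix `T_b = (1, b; 0, 1)`. -/
def Tmat {n : ℕ} (b : Cl n) : GL2 n where
  val := !![1, b; 0, 1]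
  inv := !![1, -b; 0, 1]
  val_inv := by
    ext i j
    fin_cases i <;> fin_cases j <;>
      simp [Matrix.mul_apply, Fin.sum_univ_two, Matrix.one_apply]
  inv_val := by
    ext i j
    fin_cases i <;> fin_cases j <;>
      simp [Matrix.mul_apply, Fin.sum_univ_two, Matrix.one_apply]

/-- The inversion matrix `J = (0, -1; 1, 0)`. -/
def Jmat (n : ℕ) : GL2 n where
  val := !![0, -1; 1, 0]
  inv := !![0, 1; -1, 0]
  val_inv := by
    ext i j
    fin_cases i <;> fin_cases j <;>
      simp [Matrix.mul_apply, Fin.sum_univ_two, Matrix.one_apply]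
  inv_val := by
    ext i j
    fin_cases i <;> fin_cases j <;>
      simp [Matrix.mul_apply, Fin.sum_univ_two, Matrix.one_apply]

/-- The special hypercomplex modular group `Γ_p = ⟨T_{e_1}, …, T_{e_p}, J⟩`. -/
def Gamma (n p : ℕ) : Subgroup (GL2 n) :=
  Subgroup.closure ({Jmat n} ∪ {M | ∃ i : Fin n, (i : ℕ) < p ∧ M = Tmat (eCl i)})

/-- The standard order `O_p = Σ_{A ⊆ {1,…,p}} ℤ e_A` in `Cl_n`: the subring generated by
`e_1, …, e_p`. -/
def Op (n p : ℕ) : Set (Cl n) :=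
  Subring.closure {a : Cl n | ∃ i : Fin n, (i : ℕ) < p ∧ a = eCl i}

/-- `a ∈ N·O_p`. -/
def inNOp (n p N : ℕ) (a : Cl n) : Prop := ∃ y ∈ Op n p, a = (N : ℕ) • y

/-- The principal congruence subgroup `Γ_p[N]` of level `N` (as a set of matrices). -/
def GammaN (n p N : ℕ) : Set (GL2 n) :=
  {M | M ∈ Gamma n p ∧ inNOp n p N (ent M 0 0 - 1) ∧ inNOp n p N (ent M 0 1) ∧
    inNOp n p N (ent M 1 0) ∧ inNOp n p N (ent M 1 1 - 1)}

/-- The congruence group `Γ_p^0[N] = {M ∈ Γ_p : b ∈ N·O_p}`. -/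
def Gamma0Upper (n p N : ℕ) : Set (GL2 n) :=
  {M | M ∈ Gamma n p ∧ inNOp n p N (ent M 0 1)}

/-- The congruence group `Γ_{p,0}[N] = {M ∈ Γ_p : c ∈ N·O_p}`. -/
def Gamma0Lower (n p N : ℕ) : Set (GL2 n) :=
  {M | M ∈ Gamma n p ∧ inNOp n p N (ent M 1 0)}

/-- The generalized theta group `Γ_{p,θ} = Γ_p[2] ∪ Γ_p[2]·J`. -/
def GammaTheta (n p : ℕ) : Set (GL2 n) :=
  GammaN n p 2 ∪ (fun M => M * Jmat n) '' GammaN n p 2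

/-- `Λ` is a congruence subgroup of `Γ_p`: `Γ_p[N] ⊆ Λ ⊆ Γ_p` for some `N ≥ 1`. -/
def IsCongruence (n p : ℕ) (Λ : Subgroup (GL2 n)) : Prop :=
  ∃ N : ℕ, 0 < N ∧ GammaN n p N ⊆ (Λ : Set (GL2 n)) ∧ (Λ : Set (GL2 n)) ⊆ Gamma n p

/-- `M` is a translation matrix `(1, b; 0, 1)`. -/
def IsTransMat {n : ℕ} (M : GL2 n) : Prop :=
  ∃ b : Cl n, M.val = !![1, b; 0, 1]

/-- `R : ι → GL2 n` is a system of representatives for the right cosets `T(Λ)\Λ` of the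
subgroup of translation matrices `T(Λ)` contained in `Λ`: each member of `Λ` can be written
uniquely as `T * R i` with `T` a translation matrix of `Λ`. -/
def IsRepSystem (n : ℕ) (Λ : Subgroup (GL2 n)) (ι : Type*) (R : ι → GL2 n) : Prop :=
  (∀ i, R i ∈ Λ) ∧
  (∀ M ∈ Λ, ∃! i : ι, ∃ T : GL2 n, IsTransMat T ∧ T ∈ Λ ∧ M = T * R i)

/-- The Möbius transformation `M⟨x⟩ = (ax+b)(cx+d)⁻¹` associated with a Clifford matrix,
as a map on `ℝⁿ`. -/
def mobius {n : ℕ} (M : GL2 n) (x : Fin n → ℝ) : Fin n → ℝ :=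
  vecPart ((ent M 0 0 * clVec x + ent M 0 1) *
    Ring.inverse (ent M 1 0 * clVec x + ent M 1 1))

/-- `a` is a (finite) product of vectors of `ℝⁿ`. -/
def IsProdVec {n : ℕ} (a : Cl n) : Prop :=
  ∃ l : List (Fin n → ℝ), a = (l.map (fun v => clVec v)).prod

/-- Membership in the general Vahlen group `GV(ℝⁿ)`. -/
def IsVahlen {n : ℕ} (M : Matrix (Fin 2) (Fin 2) (Cl n)) : Prop :=
  IsProdVec (M 0 0) ∧ IsProdVec (M 0 1) ∧ IsProdVec (M 1 0) ∧ IsProdVec (M 1 1) ∧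
  (∃ r : ℝ, r ≠ 0 ∧ M 0 0 * clRev (M 1 1) - M 0 1 * clRev (M 1 0) = algebraMap ℝ (Cl n) r) ∧
  (M 0 0 ≠ 0 → ∃ v : Fin n → ℝ, Ring.inverse (M 0 0) * M 0 1 = clVec v) ∧
  (M 1 0 ≠ 0 → ∃ v : Fin n → ℝ, Ring.inverse (M 1 0) * M 1 1 = clVec v)

section Aux

open CliffordAlgebra

theorem aux_contr {M : Type*} [AddCommGroup M] [Module ℝ M] {Q Q' : QuadraticForm ℝ M}
    (f : Q →qᵢ Q') (d : Module.Dual ℝ M) (y : CliffordAlgebra Q) :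
    CliffordAlgebra.map f (contractLeft (d ∘ₗ f.toLinearMap) y) =
      contractLeft d (CliffordAlgebra.map f y) := by
  induction y using CliffordAlgebra.left_induction with
  | algebraMap r => simp
  | add x y hx hy => simp only [map_add, hx, hy]
  | ι_mul x m hx =>
    rw [contractLeft_ι_mul, map_mul, map_apply_ι, contractLeft_ι_mul, map_sub, map_smul, map_mul,
      map_apply_ι, hx]
    rfl

theorem aux_change {M : Type*} [AddCommGroup M] [Module ℝ M] {Q Q' : QuadraticForm ℝ M}
    {B : LinearMap.BilinForm ℝ M} (h : B.toQuadraticMap = Q' - Q)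
    (f : Q →qᵢ Q) (f' : Q' →qᵢ Q') (hff : ∀ v, f v = f' v)
    (hB : ∀ v w, B (f v) (f w) = B v w) (y : CliffordAlgebra Q) :
    changeForm h (CliffordAlgebra.map f y) = CliffordAlgebra.map f' (changeForm h y) := by
  induction y using CliffordAlgebra.left_induction with
  | algebraMap r => simp [changeForm_algebraMap]
  | add x y hx hy => simp only [map_add, hx, hy]
  | ι_mul x m hx =>
    rw [map_mul, map_apply_ι, changeForm_ι_mul, changeForm_ι_mul, map_sub, map_mul, map_apply_ι,
      hx, ← hff m, ← aux_contr]
    congr 3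
    congr 1
    ext w
    change B (f m) (f' w) = B m w
    rw [← hff, hB]

/-- reflection in the `k`-th coordinate -/
def auxReflLin {n : ℕ} (k : Fin n) : (Fin n → ℝ) →ₗ[ℝ] (Fin n → ℝ) where
  toFun v := fun j => if j = k then - v j else v j
  map_add' v w := by
    ext j; by_cases h : j = k <;> simp [h]; ring
  map_smul' r v := by
    ext j; by_cases h : j = k <;> simp [h]

theorem auxRefl_Q {n : ℕ} (k : Fin n) (v : Fin n → ℝ) : Qf n (auxReflLin k v) = Qf n v := by
  simp only [Qf, QuadraticMap.weightedSumSquares_apply, auxReflLin, LinearMap.coe_mk,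
    AddHom.coe_mk]
  refine Finset.sum_congr rfl fun j _ => ?_
  by_cases h : j = k <;> simp [h]

def auxRefl {n : ℕ} (k : Fin n) : Qf n →qᵢ Qf n :=
  { auxReflLin k with map_app' := auxRefl_Q k }

theorem aux_equiv {n : ℕ} (a : Cl n) : equivExterior (Qf n) a =
    changeForm (Q' := (0 : QuadraticForm ℝ (Fin n → ℝ)))
      (changeForm.associated_neg_proof (Q := Qf n)) a := rfl

def auxReflZ {n : ℕ} (k : Fin n) :
    (0 : QuadraticForm ℝ (Fin n → ℝ)) →qᵢ (0 : QuadraticForm ℝ (Fin n → ℝ)) :=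
  { auxReflLin k with map_app' := fun _ => rfl }

theorem aux_assoc {n : ℕ} (k : Fin n) (v w : Fin n → ℝ) :
    QuadraticMap.associated (R := ℝ) (-Qf n) (auxRefl k v) (auxRefl k w) =
      QuadraticMap.associated (R := ℝ) (-Qf n) v w := by
  have hadd : auxRefl k v + auxRefl k w = auxRefl k (v + w) := (map_add (auxRefl k) v w).symm
  simp only [QuadraticMap.associated_apply, hadd, QuadraticMap.neg_apply,
    QuadraticMap.Isometry.map_app]

theorem aux_algInv {n : ℕ} (k : Fin n)
    (y : CliffordAlgebra (0 : QuadraticForm ℝ (Fin n → ℝ))) :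
    ExteriorAlgebra.algebraMapInv (R := ℝ) (M := Fin n → ℝ)
      (CliffordAlgebra.map (auxReflZ k) y) =
    ExteriorAlgebra.algebraMapInv (R := ℝ) (M := Fin n → ℝ) y := by
  have h2 : (ExteriorAlgebra.algebraMapInv (R := ℝ) (M := Fin n → ℝ)).comp
      (ExteriorAlgebra.map (auxReflLin k)) = ExteriorAlgebra.algebraMapInv := by
    ext v
    simp [ExteriorAlgebra.algebraMapInv]
  exact DFunLike.congr_fun h2 y

theorem aux_Sc_refl {n : ℕ} (k : Fin n) (a : Cl n) :
    Sc (CliffordAlgebra.map (auxRefl k) a) = Sc a := by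
  unfold Sc
  rw [aux_equiv, aux_equiv, aux_change _ (auxRefl k) (auxReflZ k) (fun _ => rfl) (aux_assoc k) a]
  exact aux_algInv k _

/-- subalgebra generated by the first `k` basis vectors -/
def auxS (n k : ℕ) : Subalgebra ℝ (Cl n) :=
  Algebra.adjoin ℝ {a : Cl n | ∃ i : Fin n, (i : ℕ) < k ∧ a = eCl i}

theorem auxS_e {n k : ℕ} (i : Fin n) (hi : (i : ℕ) < k) : eCl i ∈ auxS n k :=
  Algebra.subset_adjoin ⟨i, hi, rfl⟩

theorem auxS_mono {n k l : ℕ} (h : k ≤ l) : auxS n k ≤ auxS n l := by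
  refine Algebra.adjoin_mono ?_
  rintro a ⟨i, hi, rfl⟩
  exact ⟨i, by omega, rfl⟩

theorem aux_refl_fix {n : ℕ} (k : Fin n) {a : Cl n} (ha : a ∈ auxS n k) :
    CliffordAlgebra.map (auxRefl k) a = a := by
  induction ha using Algebra.adjoin_induction with
  | mem x hx =>
    obtain ⟨i, hi, rfl⟩ := hx
    unfold eCl clVec
    rw [map_apply_ι]
    congr 1
    ext j
    change (if j = k then - (Pi.single i 1 : Fin n → ℝ) j else (Pi.single i 1 : Fin n → ℝ) j) = _
    split_ifs with h
    · have : j ≠ i := by rintro rfl; subst h; omega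
      simp [this]
    · rfl
  | algebraMap r => simp
  | add x y _ _ hx hy => rw [map_add, hx, hy]
  | mul x y _ _ hx hy => rw [map_mul, hx, hy]

theorem aux_refl_e {n : ℕ} (k : Fin n) :
    CliffordAlgebra.map (auxRefl k) (eCl k) = - eCl k := by
  unfold eCl clVec
  rw [map_apply_ι, ← map_neg]
  congr 1
  ext j
  change (if j = k then - (Pi.single k 1 : Fin n → ℝ) j else (Pi.single k 1 : Fin n → ℝ) j) = _
  split_ifs with h
  · rfl
  · simp [h]

theorem aux_Sc_add {n : ℕ} (a b : Cl n) : Sc (a + b) = Sc a + Sc b := by simp [Sc]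
theorem aux_Sc_neg {n : ℕ} (a : Cl n) : Sc (-a) = - Sc a := by simp [Sc]
theorem aux_Sc_smul {n : ℕ} (r : ℝ) (a : Cl n) : Sc (r • a) = r * Sc a := by simp [Sc]
theorem aux_Sc_alg {n : ℕ} (r : ℝ) : Sc (algebraMap ℝ (Cl n) r) = r := by
  unfold Sc
  rw [aux_equiv, changeForm_algebraMap]
  exact ExteriorAlgebra.algebraMap_leftInverse (Fin n → ℝ) r

theorem aux_Sc_mid {n : ℕ} (k : Fin n) {a b : Cl n} (ha : a ∈ auxS n k) (hb : b ∈ auxS n k) :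
    Sc (a * eCl k * b) = 0 := by
  have h := aux_Sc_refl k (a * eCl k * b)
  rw [map_mul, map_mul, aux_refl_fix k ha, aux_refl_fix k hb, aux_refl_e, mul_neg, neg_mul,
    aux_Sc_neg] at h
  linarith

theorem aux_conj_add {n : ℕ} (a b : Cl n) : clConj (a + b) = clConj a + clConj b := by
  simp [clConj]
theorem aux_conj_neg {n : ℕ} (a : Cl n) : clConj (-a) = - clConj a := by
  simp [clConj]
theorem aux_conj_mul {n : ℕ} (a b : Cl n) : clConj (a * b) = clConj b * clConj a := by
  simp [clConj]
theorem aux_conj_vec {n : ℕ} (v : Fin n → ℝ) : clConj (clVec v) = - clVec v := by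
  simp [clConj, clVec]

theorem aux_conj_mem {n k : ℕ} {a : Cl n} (ha : a ∈ auxS n k) : clConj a ∈ auxS n k := by
  induction ha using Algebra.adjoin_induction with
  | mem x hx =>
    obtain ⟨i, hi, rfl⟩ := hx
    unfold eCl
    rw [aux_conj_vec]
    exact neg_mem (auxS_e i hi)
  | algebraMap r =>
    have : clConj (algebraMap ℝ (Cl n) r) = algebraMap ℝ (Cl n) r := by simp [clConj]
    rw [this]; exact Subalgebra.algebraMap_mem _ r
  | add x y _ _ hx hy => rw [aux_conj_add]; exact add_mem hx hy
  | mul x y _ _ hx hy => rw [aux_conj_mul]; exact mul_mem hy hx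

theorem aux_vec_sq {n : ℕ} (v : Fin n → ℝ) :
    clVec v * clConj (clVec v) = algebraMap ℝ (Cl n) (∑ i, v i ^ 2) := by
  rw [aux_conj_vec, mul_neg]
  unfold clVec
  rw [ι_sq_scalar, ← map_neg]
  congr 1
  simp [Qf, QuadraticMap.weightedSumSquares_apply, pow_two]

/-- squared norm -/
def auxq {n : ℕ} (a : Cl n) : ℝ := Sc (a * clConj a)

theorem auxq_mul_vec {n : ℕ} (a : Cl n) (v : Fin n → ℝ) :
    auxq (a * clVec v) = (∑ i, v i ^ 2) * auxq a := by
  unfold auxq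
  rw [aux_conj_mul, mul_assoc, ← mul_assoc (clVec v), aux_vec_sq, ← Algebra.smul_def,
    mul_smul_comm, aux_Sc_smul]

theorem auxq_vec {n : ℕ} (v : Fin n → ℝ) : auxq (clVec v) = ∑ i, v i ^ 2 := by
  unfold auxq
  rw [aux_vec_sq, aux_Sc_alg]

theorem auxq_e {n : ℕ} (k : Fin n) (a : Cl n) : auxq (a * eCl k) = auxq a := by
  unfold eCl
  rw [auxq_mul_vec]
  simp [Pi.single_apply]

theorem auxq_smul {n : ℕ} (r : ℝ) (a : Cl n) : auxq (r • a) = r ^ 2 * auxq a := by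
  unfold auxq
  have : clConj (r • a) = r • clConj a := by simp [clConj]
  rw [this, smul_mul_smul_comm, aux_Sc_smul, pow_two]

theorem auxq_split {n : ℕ} (k : Fin n) {u w : Cl n} (hu : u ∈ auxS n k) (hw : w ∈ auxS n k) :
    auxq (u + w * eCl k) = auxq u + auxq w := by
  rw [← auxq_e k w]
  unfold auxq
  have hce : clConj (eCl k) = - eCl k := aux_conj_vec _
  have h1 : Sc (u * clConj (w * eCl k)) = 0 := by
    rw [aux_conj_mul, hce, neg_mul, mul_neg, aux_Sc_neg, ← mul_assoc,
      aux_Sc_mid k hu (aux_conj_mem hw), neg_zero]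
  have h2 : Sc (w * eCl k * clConj u) = 0 := aux_Sc_mid k hw (aux_conj_mem hu)
  rw [aux_conj_add, add_mul, mul_add, mul_add, aux_Sc_add, aux_Sc_add, aux_Sc_add, h1, h2]
  ring

theorem aux_anti {n : ℕ} {i k : Fin n} (h : i ≠ k) :
    eCl k * eCl i = - (eCl i * eCl k) := by
  unfold eCl clVec
  rw [eq_neg_iff_add_eq_zero, ι_mul_ι_add_swap]
  have : QuadraticMap.polar (Qf n) (Pi.single k 1) (Pi.single i 1) = 0 := by
    simp only [QuadraticMap.polar, Qf, QuadraticMap.weightedSumSquares_apply]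
    rw [← Finset.sum_sub_distrib, ← Finset.sum_sub_distrib]
    refine Finset.sum_eq_zero fun j _ => ?_
    by_cases h1 : j = k
    · have : j ≠ i := by rintro rfl; exact h h1
      subst h1
      simp [this]
    · simp [h1]
  rw [this, map_zero]

theorem aux_commute {n : ℕ} (k : Fin n) {a : Cl n} (ha : a ∈ auxS n k) :
    ∃ b ∈ auxS n k, eCl k * a = b * eCl k := by
  induction ha using Algebra.adjoin_induction with
  | mem x hx =>
    obtain ⟨i, hi, rfl⟩ := hx
    refine ⟨- eCl i, neg_mem (auxS_e i hi), ?_⟩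
    rw [neg_mul, aux_anti]
    rintro rfl
    omega
  | algebraMap r =>
    exact ⟨_, Subalgebra.algebraMap_mem _ r, (Algebra.commutes r _).symm⟩
  | add x y _ _ hx hy =>
    obtain ⟨b, hb, hb'⟩ := hx
    obtain ⟨c, hc, hc'⟩ := hy
    exact ⟨b + c, add_mem hb hc, by rw [mul_add, add_mul, hb', hc']⟩
  | mul x y _ _ hx hy =>
    obtain ⟨b, hb, hb'⟩ := hx
    obtain ⟨c, hc, hc'⟩ := hy
    exact ⟨b * c, mul_mem hb hc, by rw [← mul_assoc, hb', mul_assoc, hc', mul_assoc]⟩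

theorem aux_e_sq {n : ℕ} (k : Fin n) : eCl k * eCl k = -1 := by
  unfold eCl clVec
  rw [ι_sq_scalar]
  have : Qf n (Pi.single k 1) = -1 := by
    simp [Qf, QuadraticMap.weightedSumSquares_apply, Pi.single_apply]
  rw [this, map_neg, map_one]

theorem aux_decomp {n : ℕ} (k : Fin n) {a : Cl n} (ha : a ∈ auxS n (k + 1)) :
    ∃ u ∈ auxS n k, ∃ w ∈ auxS n k, a = u + w * eCl k := by
  induction ha using Algebra.adjoin_induction with
  | mem x hx =>
    obtain ⟨i, hi, rfl⟩ := hx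
    by_cases h : i = k
    · subst h
      exact ⟨0, zero_mem _, 1, one_mem _, by simp⟩
    · have : (i : ℕ) ≠ k := fun h' => h (Fin.ext h')
      exact ⟨eCl i, auxS_e i (by omega), 0, zero_mem _, by simp⟩
  | algebraMap r => exact ⟨_, Subalgebra.algebraMap_mem _ r, 0, zero_mem _, by simp⟩
  | add x y _ _ hx hy =>
    obtain ⟨u, hu, w, hw, rfl⟩ := hx
    obtain ⟨u', hu', w', hw', rfl⟩ := hy
    exact ⟨u + u', add_mem hu hu', w + w', add_mem hw hw', by rw [add_mul]; abel⟩
  | mul x y _ _ hx hy =>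
    obtain ⟨u, hu, w, hw, rfl⟩ := hx
    obtain ⟨u', hu', w', hw', rfl⟩ := hy
    obtain ⟨b, hb, hb'⟩ := aux_commute k hu'
    obtain ⟨c, hc, hc'⟩ := aux_commute k hw'
    refine ⟨u * u' - w * c, sub_mem (mul_mem hu hu') (mul_mem hw hc), u * w' + w * b,
      add_mem (mul_mem hu hw') (mul_mem hw hb), ?_⟩
    have e1 : w * eCl k * u' = w * b * eCl k := by rw [mul_assoc, hb', mul_assoc]
    have e2 : w * eCl k * (w' * eCl k) = - (w * c) := by
      rw [mul_assoc, ← mul_assoc (eCl k), hc', mul_assoc c, aux_e_sq]; simp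
    rw [add_mul, mul_add, mul_add, e1, e2, add_mul, mul_assoc u w']
    abel

theorem auxq_nonneg {n : ℕ} (k : ℕ) (hk : k ≤ n) {a : Cl n} (ha : a ∈ auxS n k) :
    0 ≤ auxq a := by
  induction k generalizing a with
  | zero =>
    have h0 : auxS n 0 = ⊥ := by
      unfold auxS
      rw [show {a : Cl n | ∃ i : Fin n, (i : ℕ) < 0 ∧ a = eCl i} = ∅ by ext; simp]
      exact Algebra.adjoin_empty _ _
    rw [h0] at ha
    obtain ⟨r, rfl⟩ := Algebra.mem_bot.1 ha
    have : auxq (algebraMap ℝ (Cl n) r) = r ^ 2 := by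
      unfold auxq
      rw [show clConj (algebraMap ℝ (Cl n) r) = algebraMap ℝ (Cl n) r by simp [clConj],
        ← map_mul, aux_Sc_alg, pow_two]
    rw [this]; positivity
  | succ k ih =>
    obtain ⟨u, hu, w, hw, rfl⟩ := aux_decomp (⟨k, by omega⟩ : Fin n) ha
    rw [auxq_split _ hu hw]
    exact add_nonneg (ih (by omega) hu) (ih (by omega) hw)

theorem auxq_par {n : ℕ} (a b : Cl n) : auxq (a + b + b) + auxq a = 2 * auxq (a + b) + 2 * auxq b := by
  unfold auxq
  simp only [aux_conj_add, add_mul, mul_add, aux_Sc_add]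
  ring

theorem aux_ent {n p : ℕ} {M : GL2 n} (hM : M ∈ Gamma n p) (i j : Fin 2) :
    ent M i j ∈ auxS n p := by
  have H : (∀ i j, M.val i j ∈ auxS n p) ∧ (∀ i j, M⁻¹.val i j ∈ auxS n p) := by
    induction hM using Subgroup.closure_induction with
    | mem x hx =>
      rcases hx with rfl | ⟨i, hi, rfl⟩
      · constructor <;> intro a b <;> fin_cases a <;> fin_cases b <;>
          simp [Jmat, ← Units.inv_eq_val_inv, zero_mem, one_mem]
      · have := auxS_e i hi
        constructor <;> intro a b <;> fin_cases a <;> fin_cases b <;>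
          simp [Tmat, ← Units.inv_eq_val_inv, zero_mem, one_mem, this]
    | one =>
      constructor <;> intro a b <;> fin_cases a <;> fin_cases b <;>
          simp [zero_mem, one_mem]
    | mul x y _ _ hx hy =>
      rw [mul_inv_rev]
      constructor <;> intro a b
      · rw [Units.val_mul, Matrix.mul_apply]
        exact sum_mem fun l _ => mul_mem (hx.1 _ _) (hy.1 _ _)
      · rw [Units.val_mul, Matrix.mul_apply]
        exact sum_mem fun l _ => mul_mem (hy.2 _ _) (hx.2 _ _)
    | inv x _ hx => exact ⟨hx.2, by simpa using hx.1⟩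
  exact H.1 i j

theorem aux_vec_mem {n : ℕ} (hn : 0 < n) (τ : Fin n → ℝ) :
    clVec (setLast τ 0) ∈ auxS n (n - 1) := by
  have : clVec (setLast τ 0) = ∑ i, (setLast τ 0) i • eCl i := by
    unfold eCl clVec
    simp only [← map_smul]
    rw [← map_sum]
    congr 1
    ext j
    simp [Finset.sum_apply, Pi.single_apply]
  rw [this]
  refine sum_mem fun i _ => ?_
  by_cases h : (i : ℕ) = n - 1
  · simp [setLast, h, zero_mem]
  · exact Subalgebra.smul_mem _ (auxS_e i (by omega)) _

theorem aux_vec_split {n : ℕ} (hn : 0 < n) (τ : Fin n → ℝ) :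
    clVec τ = clVec (setLast τ 0) + lastc n τ • eCl (⟨n - 1, by omega⟩ : Fin n) := by
  unfold eCl clVec
  rw [← map_smul, ← map_add]
  congr 1
  ext j
  by_cases h : (j : ℕ) = n - 1
  · have : j = (⟨n - 1, by omega⟩ : Fin n) := Fin.ext h
    rw [Pi.add_apply, Pi.smul_apply, this]
    simp [setLast, lastc, hn]
  · have : j ≠ (⟨n - 1, by omega⟩ : Fin n) := fun h' => h (by rw [h'])
    simp [setLast, h, this]

theorem aux_en {n : ℕ} (hn : 0 < n) : clVec (enVec n) = eCl (⟨n - 1, by omega⟩ : Fin n) := by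
  unfold eCl
  congr 1
  ext j
  simp [enVec, Pi.single_apply, Fin.ext_iff]

theorem aux_final (ε t A D U X : ℝ) (hε : 0 < ε) (ht : ε < t) (hA : 0 ≤ A)
    (hU : 0 ≤ U) (hX : X ≤ (1 / ε) ^ 2) (hD : D ≤ 2 * U + 2 * (X * A)) :
    A + D ≤ (2 + (1 + 2 * (1 / ε) ^ 2) * (1 / ε) ^ 2) * (U + t ^ 2 * A) := by
  set y := (1 / ε) ^ 2 with hy
  have hy0 : 0 < y := by positivity
  have h1 : 1 ≤ y * t ^ 2 := by
    have : 1 ≤ 1 / ε * t := by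
      rw [one_div, inv_mul_eq_div, le_div_iff₀ hε]; linarith
    calc (1 : ℝ) ≤ (1 / ε * t) ^ 2 := one_le_pow₀ this
      _ = _ := by rw [mul_pow]
  have h2 : X * A ≤ y * A := mul_le_mul_of_nonneg_right hX hA
  have h3 : A ≤ y * t ^ 2 * A := le_mul_of_one_le_left hA h1
  have h4 : 0 ≤ y * U := by positivity
  have h5 : 0 ≤ y * (y * U) := by positivity
  have h6 : y * A ≤ y * (y * t ^ 2 * A) := mul_le_mul_of_nonneg_left h3 hy0.le
  have h7 : 0 ≤ t ^ 2 * A := by positivity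
  nlinarith

end Aux

/-- the uniform lower bound `‖cτ + d‖ ≥ ρ ‖c e_n + d‖` on vertical strips. -/
theorem stmt9 (n p : ℕ) (hn : 0 < n) (hp : 0 < p) (hpn : p ≤ n - 1)
    (Λ : Subgroup (GL2 n)) (hΛ : IsCongruence n p Λ)
    (ε : ℝ) (hε : 0 < ε) :
    ∃ ρ : ℝ, 0 < ρ ∧ ∀ M ∈ Λ, ∀ τ ∈ Vstrip n ε,
      ρ * clNorm (ent M 1 0 * clVec (enVec n) + ent M 1 1) ≤
        clNorm (ent M 1 0 * clVec τ + ent M 1 1) := by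
  obtain ⟨N, hN, -, hsub⟩ := hΛ
  set K : ℝ := 2 + (1 + 2 * (1 / ε) ^ 2) * (1 / ε) ^ 2 with hK
  have hK0 : 0 < K := by positivity
  refine ⟨1 / Real.sqrt K, by positivity, ?_⟩
  intro M hM τ hτ
  obtain ⟨hτ1, hτ2⟩ := hτ
  have hc : ent M 1 0 ∈ auxS n (n - 1) := auxS_mono hpn (aux_ent (hsub hM) 1 0)
  have hd : ent M 1 1 ∈ auxS n (n - 1) := auxS_mono hpn (aux_ent (hsub hM) 1 1)
  generalize ent M 1 0 = c at hc ⊢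
  generalize ent M 1 1 = d at hd ⊢
  have hx := aux_vec_mem hn τ
  have hcx := mul_mem hc hx
  have hX : ∑ i, (setLast τ 0) i ^ 2 ≤ (1 / ε) ^ 2 := by
    have h := hτ1
    rw [clNorm, Real.sqrt_le_left (by positivity)] at h
    rw [← auxq_vec]; exact h
  have hle : n - 1 ≤ n := by omega
  have hA := auxq_nonneg _ hle hc
  have hU := auxq_nonneg _ hle (add_mem hd hcx)
  have hD : auxq d ≤ 2 * auxq (d + c * clVec (setLast τ 0))
      + 2 * ((∑ i, (setLast τ 0) i ^ 2) * auxq c) := by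
    have h1 := auxq_par d (c * clVec (setLast τ 0))
    have h2 := auxq_nonneg _ hle (add_mem (add_mem hd hcx) hcx)
    rw [auxq_mul_vec] at h1
    linarith
  have e1 : auxq (c * clVec (enVec n) + d) = auxq c + auxq d := by
    rw [aux_en hn, add_comm, auxq_split (⟨n - 1, by omega⟩ : Fin n) hd hc, add_comm]
  have e2 : auxq (c * clVec τ + d) =
      auxq (d + c * clVec (setLast τ 0)) + (lastc n τ) ^ 2 * auxq c := by
    rw [← auxq_smul, ← auxq_split (⟨n - 1, by omega⟩ : Fin n) (add_mem hd hcx)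
      (Subalgebra.smul_mem _ hc _), aux_vec_split hn τ, mul_add, mul_smul_comm, smul_mul_assoc]
    congr 1
    abel
  have hfin := aux_final ε (lastc n τ) _ _ _ _ hε hτ2 hA hU hX hD
  rw [← e1, ← e2, ← hK] at hfin
  have hs : Real.sqrt (auxq (c * clVec (enVec n) + d)) ≤
      Real.sqrt K * Real.sqrt (auxq (c * clVec τ + d)) := by
    rw [← Real.sqrt_mul hK0.le]
    exact Real.sqrt_le_sqrt hfin
  change 1 / Real.sqrt K * Real.sqrt (auxq (c * clVec (enVec n) + d)) ≤
    Real.sqrt (auxq (c * clVec τ + d))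
  rw [one_div, inv_mul_le_iff₀ (by positivity)]
  exact hs
end
end

section
/- Let M = (a,b;c,d) be a matrix of the general Vahlen group GV(ℝⁿ) and let x ∈ ℝⁿ be a vector such that cx + d is invertible in Cl_n. Then (ax+b)(cx+d)^{-1} = (xc* + d*)^{-1}(xa* + b*), where * denotes the reversion anti-automorphism; this uses that x* = x for every vector x ∈ ℝⁿ. -/
noncomputable section

open CliffordAlgebra Filter

attribute [local instance] Classical.propDecidable

theorem clRev_mul {n : ℕ} (a b : Cl n) : clRev (a * b) = clRev b * clRev a :=
  CliffordAlgebra.reverse.map_mul a b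

theorem clRev_add {n : ℕ} (a b : Cl n) : clRev (a + b) = clRev a + clRev b := by
  simp [clRev]

theorem clRev_neg {n : ℕ} (a : Cl n) : clRev (-a) = -clRev a := by
  simp [clRev]

theorem clRev_zero {n : ℕ} : clRev (0 : Cl n) = 0 := by
  simp [clRev]

theorem clRev_rev {n : ℕ} (a : Cl n) : clRev (clRev a) = a :=
  CliffordAlgebra.reverse_reverse a

theorem clRev_vec {n : ℕ} (x : Fin n → ℝ) : clRev (clVec x) = clVec x :=
  CliffordAlgebra.reverse_ι x

theorem clRev_alg {n : ℕ} (r : ℝ) :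
    clRev (algebraMap ℝ (Cl n) r) = algebraMap ℝ (Cl n) r :=
  CliffordAlgebra.reverse.commutes r

theorem clRev_isUnit {n : ℕ} {a : Cl n} (h : IsUnit a) : IsUnit (clRev a) := by
  obtain ⟨u, rfl⟩ := h
  have h1 : clRev (1 : Cl n) = 1 := CliffordAlgebra.reverse.map_one
  refine ⟨⟨clRev u, clRev (↑u⁻¹ : Cl n), ?_, ?_⟩, rfl⟩
  · rw [← clRev_mul, Units.inv_mul, h1]
  · rw [← clRev_mul, Units.mul_inv, h1]

theorem clVec_isUnit {n : ℕ} {v : Fin n → ℝ} (hv : v ≠ 0) : IsUnit (clVec v) := by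
  have hq : Qf n v ≠ 0 := by
    intro h
    apply hv
    simp only [Qf, QuadraticMap.weightedSumSquares_apply, smul_eq_mul, neg_mul, one_mul,
      Finset.sum_neg_distrib, neg_eq_zero] at h
    rw [Finset.sum_eq_zero_iff_of_nonneg (fun i _ => mul_self_nonneg _)] at h
    funext i
    exact mul_self_eq_zero.mp (h i (Finset.mem_univ i))
  have h2 : clVec v * clVec v = algebraMap ℝ (Cl n) (Qf n v) :=
    CliffordAlgebra.ι_sq_scalar (Qf n) v
  have h3 : IsUnit (clVec v * clVec v) := by
    rw [h2]
    exact (IsUnit.mk0 _ hq).map (algebraMap ℝ (Cl n))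
  exact ((Commute.refl (clVec v)).isUnit_mul_iff.mp h3).1

theorem isProdVec_isUnit {n : ℕ} {a : Cl n} (h : IsProdVec a) (ha : a ≠ 0) : IsUnit a := by
  obtain ⟨l, rfl⟩ := h
  induction l with
  | nil => simp
  | cons v l ih =>
    rw [List.map_cons, List.prod_cons] at ha ⊢
    refine (clVec_isUnit ?_).mul (ih (right_ne_zero_of_mul ha))
    rintro rfl
    exact left_ne_zero_of_mul ha (by simp [clVec])

theorem of_inverse_mul {n : ℕ} {a b : Cl n} {v : Cl n} (ha : IsUnit a)
    (h : Ring.inverse a * b = v) : b = a * v := by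
  rw [← h, Ring.mul_inverse_cancel_left _ _ ha]

/-- If `a * t` is a scalar and `a` a unit then `t * a` is the same scalar. -/
theorem scalar_swap {n : ℕ} {a t : Cl n} {r : ℝ} (ha : IsUnit a)
    (h : a * t = algebraMap ℝ (Cl n) r) : t * a = algebraMap ℝ (Cl n) r := by
  apply ha.mul_left_cancel
  rw [← mul_assoc, h, Algebra.commutes]

/-- The relations between the entries of a Vahlen matrix. -/
theorem vahlen_rel {n : ℕ} {M : Matrix (Fin 2) (Fin 2) (Cl n)} (hM : IsVahlen M) :
    clRev (M 1 0) * M 0 0 = clRev (M 0 0) * M 1 0 ∧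
    clRev (M 1 1) * M 0 1 = clRev (M 0 1) * M 1 1 ∧
    ∃ r : ℝ, clRev (M 0 0) * M 1 1 = clRev (M 1 0) * M 0 1 + algebraMap ℝ (Cl n) r := by
  obtain ⟨pa, -, pc, -, ⟨r, hr, hdet⟩, hv, hw⟩ := hM
  generalize M 0 0 = a at *
  generalize M 0 1 = b at *
  generalize M 1 0 = c at *
  generalize M 1 1 = d at *
  have hs : IsUnit (algebraMap ℝ (Cl n) r) := (IsUnit.mk0 _ hr).map (algebraMap ℝ (Cl n))
  have hcomm : ∀ t : Cl n, algebraMap ℝ (Cl n) r * t = t * algebraMap ℝ (Cl n) r :=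
    fun t => Algebra.commutes r t
  have hrs : clRev (algebraMap ℝ (Cl n) r) = algebraMap ℝ (Cl n) r := clRev_alg r
  by_cases ha : a = 0
  · subst ha
    have hc : c ≠ 0 := by
      rintro rfl
      simp only [clRev_zero, mul_zero, zero_mul, sub_zero] at hdet
      exact hs.ne_zero hdet.symm
    obtain ⟨w, hw⟩ := hw hc
    have uc := isProdVec_isUnit pc hc
    have hd := of_inverse_mul uc hw
    subst hd
    have h0 : clRev c * -b = algebraMap ℝ (Cl n) r := by
      have h1 : clRev (c * -clRev b) = algebraMap ℝ (Cl n) r := by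
        rw [clRev_mul, clRev_neg, clRev_rev]
        simpa using hdet
      have h2 : c * -clRev b = algebraMap ℝ (Cl n) r := by
        rw [← clRev_rev (c * -clRev b), h1, hrs]
      have h3 := scalar_swap uc h2
      rw [← hrs, ← h3, clRev_mul, clRev_neg, clRev_rev]
    have h1 : clRev c * b = -algebraMap ℝ (Cl n) r := by
      rw [← h0]; simp
    have h2 : clRev b * c = -algebraMap ℝ (Cl n) r := by
      rw [← hrs, ← clRev_neg, ← h1, clRev_mul, clRev_rev]
    refine ⟨by simp [clRev_zero], ?_, r, ?_⟩
    · rw [clRev_mul, clRev_vec, mul_assoc, h1, ← mul_assoc, h2, mul_neg, neg_mul, hcomm]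
    · rw [h1]; simp [clRev_zero]
  · obtain ⟨v, hv⟩ := hv ha
    have ua := isProdVec_isUnit pa ha
    have hb := of_inverse_mul ua hv
    subst hb
    by_cases hc : c = 0
    · subst hc
      have h0 : a * clRev d = algebraMap ℝ (Cl n) r := by
        simpa [clRev_zero] using hdet
      have h1 := scalar_swap ua h0
      have h2 : clRev a * d = algebraMap ℝ (Cl n) r := by
        rw [← hrs, ← h1, clRev_mul, clRev_rev]
      refine ⟨by simp [clRev_zero], ?_, r, ?_⟩
      · rw [clRev_mul, clRev_vec, mul_assoc, h2, ← mul_assoc, h1, hcomm]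
      · rw [h2]; simp [clRev_zero]
    · obtain ⟨w, hw⟩ := hw hc
      have uc := isProdVec_isUnit pc hc
      have hd := of_inverse_mul uc hw
      subst hd
      have h0 : a * ((clVec w - clVec v) * clRev c) = algebraMap ℝ (Cl n) r := by
        rw [← hdet, clRev_mul, clRev_vec]
        noncomm_ring
      have h1 := scalar_swap ua h0
      have hu : clRev (clVec w - clVec v) = clVec w - clVec v := by
        rw [sub_eq_add_neg, clRev_add, clRev_neg, clRev_vec, clRev_vec]
      have h2 : clRev a * c * (clVec w - clVec v) = algebraMap ℝ (Cl n) r := by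
        rw [← hrs, ← h1, clRev_mul, clRev_mul, clRev_rev, hu, mul_assoc]
      rw [mul_assoc] at h1
      have hk : clRev c * a = clRev a * c := by
        apply hs.mul_left_cancel
        conv_lhs => rw [← h2]
        rw [mul_assoc, h1, hcomm]
      rw [hk] at h1
      generalize hK : clRev a * c = k at *
      refine ⟨hk, ?_, r, ?_⟩
      · rw [clRev_mul, clRev_mul, clRev_vec, clRev_vec]
        have e1 : clVec w * clRev c * (a * clVec v) = clVec w * k * clVec v := by
          rw [← hk]; noncomm_ring
        have e2 : clVec v * clRev a * (c * clVec w) = clVec v * k * clVec w := by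
          rw [← hK]; noncomm_ring
        rw [e1, e2, ← sub_eq_zero]
        have e3 : clVec w * k * clVec v - clVec v * k * clVec w =
            (clVec w - clVec v) * k * clVec v - clVec v * (k * (clVec w - clVec v)) := by
          noncomm_ring
        rw [e3, h1, h2, hcomm, sub_self]
      · rw [← mul_assoc, ← mul_assoc, hK, hk, ← h2]
        noncomm_ring

theorem vahlen_key {n : ℕ} {M : Matrix (Fin 2) (Fin 2) (Cl n)} (hM : IsVahlen M)
    (x : Fin n → ℝ) :
    (clVec x * clRev (M 1 0) + clRev (M 1 1)) * (M 0 0 * clVec x + M 0 1) =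
      (clVec x * clRev (M 0 0) + clRev (M 0 1)) * (M 1 0 * clVec x + M 1 1) := by
  obtain ⟨h1, h2, r, h3⟩ := vahlen_rel hM
  have h4 : clRev (M 1 1) * M 0 0 = clRev (M 0 1) * M 1 0 + algebraMap ℝ (Cl n) r := by
    have := congrArg clRev h3
    simpa only [clRev_mul, clRev_add, clRev_rev, clRev_alg] using this
  have e1 : (clVec x * clRev (M 1 0) + clRev (M 1 1)) * (M 0 0 * clVec x + M 0 1) =
      clVec x * (clRev (M 1 0) * M 0 0) * clVec x + clVec x * (clRev (M 1 0) * M 0 1) +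
        (clRev (M 1 1) * M 0 0) * clVec x + clRev (M 1 1) * M 0 1 := by
    noncomm_ring
  have e2 : (clVec x * clRev (M 0 0) + clRev (M 0 1)) * (M 1 0 * clVec x + M 1 1) =
      clVec x * (clRev (M 0 0) * M 1 0) * clVec x + clVec x * (clRev (M 0 0) * M 1 1) +
        (clRev (M 0 1) * M 1 0) * clVec x + clRev (M 0 1) * M 1 1 := by
    noncomm_ring
  rw [e1, e2, h1, h2, h3, h4, mul_add, add_mul, Algebra.commutes]
  abel

/-- the two representations `(ax+b)(cx+d)⁻¹ = (xc*+d*)⁻¹(xa*+b*)` of a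
Möbius transformation attached to a Vahlen matrix. -/
theorem stmt15 (n : ℕ) (M : Matrix (Fin 2) (Fin 2) (Cl n)) (hM : IsVahlen M)
    (x : Fin n → ℝ) (hinv : IsUnit (M 1 0 * clVec x + M 1 1)) :
    (M 0 0 * clVec x + M 0 1) * Ring.inverse (M 1 0 * clVec x + M 1 1) =
      Ring.inverse (clVec x * clRev (M 1 0) + clRev (M 1 1)) *
        (clVec x * clRev (M 0 0) + clRev (M 0 1)) := by
  have hP := clRev_isUnit hinv
  have hk := vahlen_key hM x
  have e : clRev (M 1 0 * clVec x + M 1 1) = clVec x * clRev (M 1 0) + clRev (M 1 1) := by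
    rw [clRev_add, clRev_mul, clRev_vec]
  rw [e] at hP
  obtain ⟨p, hp⟩ := hinv
  obtain ⟨q, hq⟩ := hP
  rw [← hp, ← hq] at hk ⊢
  rw [Ring.inverse_unit, Ring.inverse_unit, Units.mul_inv_eq_iff_eq_mul, mul_assoc,
    ← hk, Units.inv_mul_cancel_left]
end
end
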